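/- Assume D satisfies conditions (A) and (B). Let 1 ≤ p < γ ≤ 2, let ω be a control function on [0,T], let x : [0,T] → ℝⁿ be continuous with |x_t − x_s| ≤ ω(s,t)^{1/p}, let σ ∈ C¹_b(ℝ^d, L(ℝⁿ,ℝ^d)), and let C₀ > 1 be a Skorohod local-time constant for D. Set C₁ = 3C₀‖σ‖_∞, C₂ = 1 + 4C₀‖σ‖_∞ and M = 2C₂‖Dσ‖_∞/(1 − 2^{1−γ/p}). Then there exists ε ∈ (0,1], depending only on ‖σ‖_∞, ‖Dσ‖_∞ and C₀, such that for every partition Δ = {t_k} of [0,T], every Euler approximation (y^Δ, Φ^Δ) starting at y₀ ∈ cl(D), every partition point t_k, and all s, t with t_k ≤ s ≤ t and ω(t_k, t) ≤ ε, one has |I^Δ_{t_k}(t)| ≤ M ω(t_k,t)^{γ/p} and ‖Φ^Δ‖_{[s,t]} ≤ C₁ ω(s,t)^{1/p}. -/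

import Mathlib

open MeasureTheory Set
open scoped RealInnerProductSpace

noncomputable section

/-- The set of inward unit normal vectors at `x` at radius `r`. -/
def normalVecsAt {d : ℕ} (D : Set (EuclideanSpace ℝ (Fin d)))
    (x : EuclideanSpace ℝ (Fin d)) (r : ℝ) : Set (EuclideanSpace ℝ (Fin d)) :=
  {v | ‖v‖ = 1 ∧ Metric.ball (x - r • v) r ∩ D = ∅}

/-- The set of inward unit normal vectors at `x`. -/
def normalCone {d : ℕ} (D : Set (EuclideanSpace ℝ (Fin d)))
    (x : EuclideanSpace ℝ (Fin d)) : Set (EuclideanSpace ℝ (Fin d)) :=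
  ⋃ r ∈ Set.Ioi (0 : ℝ), normalVecsAt D x r

/-- Condition (A). -/
def CondA {d : ℕ} (D : Set (EuclideanSpace ℝ (Fin d))) (r₀ : ℝ) : Prop :=
  0 < r₀ ∧ ∀ x ∈ frontier D,
    normalCone D x = normalVecsAt D x r₀ ∧ (normalCone D x).Nonempty

/-- Condition (B). -/
def CondB {d : ℕ} (D : Set (EuclideanSpace ℝ (Fin d))) (δ β : ℝ) : Prop :=
  0 < δ ∧ 1 ≤ β ∧ ∀ x ∈ frontier D, ∃ l : EuclideanSpace ℝ (Fin d), ‖l‖ = 1 ∧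
    ∀ y ∈ Metric.ball x δ ∩ frontier D, ∀ v ∈ normalCone D y, 1 / β ≤ ⟪l, v⟫

/-- `‖w‖_{∞,[s,t]}`, the supremum of increments of `w` over `[s,t]`. -/
def supNorm {E : Type*} [NormedAddCommGroup E] (w : ℝ → E) (s t : ℝ) : ℝ :=
  sSup ((fun q : ℝ × ℝ => ‖w q.2 - w q.1‖) '' {q | s ≤ q.1 ∧ q.1 ≤ q.2 ∧ q.2 ≤ t})

/-- `‖φ‖_{[s,t]}`, the total variation of `φ` on `[s,t]`. -/
def totalVar {E : Type*} [NormedAddCommGroup E] (φ : ℝ → E) (s t : ℝ) : ℝ :=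
  (eVariationOn φ (Set.Icc s t)).toReal

/-- A control function on `[0,T]`. -/
structure IsControl (T : ℝ) (ω : ℝ → ℝ → ℝ) : Prop where
  cont : ContinuousOn (fun q : ℝ × ℝ => ω q.1 q.2) {q | 0 ≤ q.1 ∧ q.1 ≤ q.2 ∧ q.2 ≤ T}
  diag : ∀ t, 0 ≤ t → t ≤ T → ω t t = 0
  superadd : ∀ s t u, 0 ≤ s → s ≤ t → t ≤ u → u ≤ T → ω s t + ω t u ≤ ω s u

/-- `(ξ, φ)` is a solution of the Skorohod problem associated with `w` on `[a,b]`. -/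
structure SkorohodSol {d : ℕ} (D : Set (EuclideanSpace ℝ (Fin d))) (a b : ℝ)
    (w ξ φ : ℝ → EuclideanSpace ℝ (Fin d)) : Prop where
  xi_cont : ContinuousOn ξ (Set.Icc a b)
  xi_mem : ∀ t ∈ Set.Icc a b, ξ t ∈ closure D
  phi_cont : ContinuousOn φ (Set.Icc a b)
  phi_bv : BoundedVariationOn φ (Set.Icc a b)
  phi_start : φ a = 0
  eqn : ∀ t ∈ Set.Icc a b, ξ t = w t + φ t
  localTime : ∃ (nv : ℝ → EuclideanSpace ℝ (Fin d)) (μ : Measure ℝ),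
    Measurable nv ∧
    (∀ s ∈ Set.Icc a b, ξ s ∈ frontier D → nv s ∈ normalCone D (ξ s)) ∧
    (∀ u v, a ≤ u → u ≤ v → v ≤ b → μ (Set.Ioc u v) = ENNReal.ofReal (totalVar φ u v)) ∧
    (∀ t ∈ Set.Icc a b,
      φ t = ∫ s in Set.Icc a t, (frontier D).indicator (fun _ => (1 : ℝ)) (ξ s) • nv s ∂μ)

/-- `σ` is `C¹_b`: continuously differentiable, bounded, with bounded derivative. -/
def IsC1b {d n : ℕ}
    (σ : EuclideanSpace ℝ (Fin d) → EuclideanSpace ℝ (Fin n) →L[ℝ] EuclideanSpace ℝ (Fin d)) :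
    Prop :=
  ContDiff ℝ 1 σ ∧ (∃ K, ∀ y, ‖σ y‖ ≤ K) ∧ (∃ K, ∀ y, ‖fderiv ℝ σ y‖ ≤ K)

/-- `‖σ‖_∞`, the sup norm of `σ`. -/
def sigmaSup {d n : ℕ}
    (σ : EuclideanSpace ℝ (Fin d) → EuclideanSpace ℝ (Fin n) →L[ℝ] EuclideanSpace ℝ (Fin d)) :
    ℝ :=
  ⨆ y, ‖σ y‖

/-- `‖Dσ‖_∞`, the sup norm of the derivative of `σ`. -/
def sigmaDerivSup {d n : ℕ}
    (σ : EuclideanSpace ℝ (Fin d) → EuclideanSpace ℝ (Fin n) →L[ℝ] EuclideanSpace ℝ (Fin d)) :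
    ℝ :=
  ⨆ y, ‖fderiv ℝ σ y‖

/-- `C₀` is a Skorohod local-time constant for `D` (w.r.t. exponent `p` on `[0,T]`). -/
def IsLocalTimeConst {d : ℕ} (D : Set (EuclideanSpace ℝ (Fin d))) (T p C₀ : ℝ) : Prop :=
  1 < C₀ ∧
  ∀ ω : ℝ → ℝ → ℝ, IsControl T ω →
    ∀ w ξ φ : ℝ → EuclideanSpace ℝ (Fin d),
      ContinuousOn w (Set.Icc 0 T) →
      (∀ s t, 0 ≤ s → s ≤ t → t ≤ T → ‖w t - w s‖ ≤ ω s t ^ (1 / p)) →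
      SkorohodSol D 0 T w ξ φ →
      ∀ s t, 0 ≤ s → s ≤ t → t ≤ T →
        totalVar φ s t ≤
          C₀ * (ω s t + 1) * (Real.exp (C₀ * ω s t ^ (1 / p)) + 1) * ω s t ^ (1 / p)

/-- `t` is a partition `0 = t_0 < t_1 < ⋯ < t_N = T` of `[0,T]`. -/
def IsPartition (T : ℝ) {N : ℕ} (t : Fin (N + 1) → ℝ) : Prop :=
  StrictMono t ∧ t 0 = 0 ∧ t (Fin.last N) = T

/-- `(y, Φ)` is the Euler approximation associated with the partition `t`: on each
interval `[t_{k-1}, t_k]` the pair `(y, Φ(·) − Φ(t_{k-1}))` solves the Skorohod problem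
for `u ↦ y(t_{k-1}) + σ(y(t_{k-1}))(x_u − x_{t_{k-1}})`. -/
def IsEulerApprox {d n : ℕ} (D : Set (EuclideanSpace ℝ (Fin d)))
    (σ : EuclideanSpace ℝ (Fin d) → EuclideanSpace ℝ (Fin n) →L[ℝ] EuclideanSpace ℝ (Fin d))
    (x : ℝ → EuclideanSpace ℝ (Fin n)) {N : ℕ} (t : Fin (N + 1) → ℝ)
    (y Φ : ℝ → EuclideanSpace ℝ (Fin d)) (y₀ : EuclideanSpace ℝ (Fin d)) : Prop :=
  y (t 0) = y₀ ∧ Φ (t 0) = 0 ∧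
  ∀ k : Fin N, SkorohodSol D (t k.castSucc) (t k.succ)
    (fun u => y (t k.castSucc) + σ (y (t k.castSucc)) (x u - x (t k.castSucc)))
    y (fun u => Φ u - Φ (t k.castSucc))

/-! ### Segments of solutions -/

/-- `(ξ, Φ - Φ a)` is a Skorohod solution on `[a,b]` in a normalised form. -/
structure Seg {d : ℕ} (D : Set (EuclideanSpace ℝ (Fin d))) (a b : ℝ)
    (ξ Φ : ℝ → EuclideanSpace ℝ (Fin d)) : Prop where
  xc : ContinuousOn ξ (Set.Icc a b)
  xm : ∀ t ∈ Set.Icc a b, ξ t ∈ closure D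
  pc : ContinuousOn Φ (Set.Icc a b)
  bv : BoundedVariationOn Φ (Set.Icc a b)
  lt : ∃ (nv : ℝ → EuclideanSpace ℝ (Fin d)) (μ : Measure ℝ),
    Measurable nv ∧
    (∀ s ∈ Set.Icc a b, ξ s ∈ frontier D → nv s ∈ normalCone D (ξ s)) ∧
    (∀ u v, a ≤ u → u ≤ v → v ≤ b → μ (Set.Ioc u v) = ENNReal.ofReal (totalVar Φ u v)) ∧
    IntegrableOn (fun s => (frontier D).indicator (fun _ => (1 : ℝ)) (ξ s) • nv s)
      (Set.Ioc a b) μ ∧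
    (∀ t ∈ Set.Icc a b,
      Φ t - Φ a = ∫ s in Set.Ioc a t, (frontier D).indicator (fun _ => (1 : ℝ)) (ξ s) • nv s ∂μ)

lemma eVar_sub_const {E : Type*} [NormedAddCommGroup E] (φ : ℝ → E) (c : E) (s : Set ℝ) :
    eVariationOn (fun u => φ u - c) s = eVariationOn φ s := by
  simp [eVariationOn, edist_sub_right]

lemma totalVar_sub_const {E : Type*} [NormedAddCommGroup E] (φ : ℝ → E) (c : E) (s t : ℝ) :
    totalVar (fun u => φ u - c) s t = totalVar φ s t := by
  unfold totalVar; rw [eVar_sub_const]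

lemma norm_normalCone {d : ℕ} {D : Set (EuclideanSpace ℝ (Fin d))}
    {x v : EuclideanSpace ℝ (Fin d)} (h : v ∈ normalCone D x) : ‖v‖ = 1 := by
  unfold normalCone normalVecsAt at h
  simp only [mem_iUnion] at h
  obtain ⟨r, _, h⟩ := h
  exact h.1

lemma Seg.of_sol {d : ℕ} {D : Set (EuclideanSpace ℝ (Fin d))} {a b : ℝ} (hab : a ≤ b)
    {w ξ Φ : ℝ → EuclideanSpace ℝ (Fin d)}
    (h : SkorohodSol D a b w ξ (fun u => Φ u - Φ a)) : Seg D a b ξ Φ := by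
  obtain ⟨nv, μ, hnv, hcone, hμ, hInteg⟩ := h.localTime
  have hbv : BoundedVariationOn Φ (Set.Icc a b) := by
    have := h.phi_bv
    unfold BoundedVariationOn at this ⊢
    rwa [eVar_sub_const] at this
  refine ⟨h.xi_cont, h.xi_mem, ?_, hbv, nv, μ, hnv, hcone, ?_, ?_, ?_⟩
  · have := h.phi_cont.add (continuousOn_const (c := Φ a))
    refine this.congr fun u _ => ?_
    simp
  · intro u v hu huv hv
    rw [hμ u v hu huv hv, totalVar_sub_const]
  all_goals
    set f : ℝ → EuclideanSpace ℝ (Fin d) :=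
      fun s => (frontier D).indicator (fun _ => (1 : ℝ)) (ξ s) • nv s with hf
    have hI : IntegrableOn f (Set.Ioc a b) μ := by
      have hcl : IsClosed (Set.Icc a b ∩ ξ ⁻¹' (frontier D)) :=
        h.xi_cont.preimage_isClosed_of_isClosed isClosed_Icc isClosed_frontier
      have hfin : μ (Set.Ioc a b) < ⊤ := by
        rw [hμ a b le_rfl hab le_rfl]; exact ENNReal.ofReal_lt_top
      have heq : Set.EqOn ((Set.Icc a b ∩ ξ ⁻¹' (frontier D)).indicator nv) f (Set.Ioc a b) := by
        intro s hs
        have hs' : s ∈ Set.Icc a b := ⟨hs.1.le, hs.2⟩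
        by_cases hx : ξ s ∈ frontier D
        · rw [Set.indicator_of_mem (show s ∈ Set.Icc a b ∩ ξ ⁻¹' (frontier D) from ⟨hs', hx⟩)]
          simp [hf, hx]
        · rw [Set.indicator_of_notMem (show s ∉ Set.Icc a b ∩ ξ ⁻¹' (frontier D) from fun hh => hx hh.2)]
          simp [hf, hx]
      refine IntegrableOn.congr_fun ?_ heq measurableSet_Ioc
      refine Measure.integrableOn_of_bounded (M := 1) hfin.ne
        (hnv.indicator hcl.measurableSet).aestronglyMeasurable ?_
      refine Filter.Eventually.of_forall fun s => ?_
      by_cases hs : s ∈ Set.Icc a b ∩ ξ ⁻¹' (frontier D)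
      · rw [Set.indicator_of_mem hs, norm_normalCone (hcone s hs.1 hs.2)]
      · rw [Set.indicator_of_notMem hs]; simp
  · exact hI
  · intro t ht
    have hIt : IntegrableOn f (Set.Ioc a t) μ := hI.mono_set (Set.Ioc_subset_Ioc_right ht.2)
    by_cases hA : IntegrableOn f {a} μ
    · have h0 := hInteg a ⟨le_rfl, hab⟩
      have h1 := hInteg t ht
      simp only [Set.Icc_self, sub_self] at h0
      have h2 : Set.Icc a t = {a} ∪ Set.Ioc a t := by
        rw [Set.singleton_union, Set.insert_eq]
        exact (Set.singleton_union (a := a) ▸ (Set.Ioc_insert_left ht.1).symm)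
      rw [h2, setIntegral_union (by simp) measurableSet_Ioc hA hIt, ← h0, zero_add] at h1
      exact h1
    · have hz : ∀ t ∈ Set.Icc a b, Φ t - Φ a = 0 := by
        intro t ht
        have h1 := hInteg t ht
        rw [integral_undef] at h1
        · exact h1
        · intro hh
          exact hA (IntegrableOn.mono_set (t := Set.Icc a t) hh (by simpa using ht.1))
      have hm : μ (Set.Ioc a b) = 0 := by
        rw [hμ a b le_rfl hab le_rfl]
        unfold totalVar
        rw [eVariationOn.constant_on]
        · simp
        · rintro _ ⟨s, hs, rfl⟩ _ ⟨s', hs', rfl⟩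
          simp only [hz s hs, hz s' hs']
      have hm' : μ (Set.Ioc a t) = 0 := measure_mono_null (Set.Ioc_subset_Ioc_right ht.2) hm
      rw [hz t ht, Measure.restrict_eq_zero.2 hm', integral_zero_measure]

lemma bv_Icc_union {d : ℕ} {Φ : ℝ → EuclideanSpace ℝ (Fin d)} {a b c : ℝ} (hab : a ≤ b)
    (hbc : b ≤ c) (h1 : BoundedVariationOn Φ (Set.Icc a b))
    (h2 : BoundedVariationOn Φ (Set.Icc b c)) : BoundedVariationOn Φ (Set.Icc a c) := by
  unfold BoundedVariationOn at *
  have := eVariationOn.Icc_add_Icc Φ (s := Set.univ) hab hbc (Set.mem_univ b)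
  simp only [Set.univ_inter] at this
  rw [← this]
  exact ENNReal.add_ne_top.2 ⟨h1, h2⟩

lemma totalVar_add {d : ℕ} {Φ : ℝ → EuclideanSpace ℝ (Fin d)} {a b c : ℝ} (hab : a ≤ b)
    (hbc : b ≤ c) (h1 : BoundedVariationOn Φ (Set.Icc a b))
    (h2 : BoundedVariationOn Φ (Set.Icc b c)) :
    totalVar Φ a c = totalVar Φ a b + totalVar Φ b c := by
  have := eVariationOn.Icc_add_Icc Φ (s := Set.univ) hab hbc (Set.mem_univ b)
  simp only [Set.univ_inter] at this
  unfold totalVar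
  rw [← this, ENNReal.toReal_add h1 h2]

lemma totalVar_nonneg {d : ℕ} (Φ : ℝ → EuclideanSpace ℝ (Fin d)) (a b : ℝ) :
    0 ≤ totalVar Φ a b := ENNReal.toReal_nonneg

lemma norm_sub_le_totalVar {d : ℕ} {Φ : ℝ → EuclideanSpace ℝ (Fin d)} {a b : ℝ} (hab : a ≤ b)
    (h1 : BoundedVariationOn Φ (Set.Icc a b)) : ‖Φ b - Φ a‖ ≤ totalVar Φ a b := by
  rw [← dist_eq_norm]
  exact h1.dist_le ⟨hab, le_rfl⟩ ⟨le_rfl, hab⟩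

lemma Seg.concat {d : ℕ} {D : Set (EuclideanSpace ℝ (Fin d))} {a b c : ℝ} (hab : a ≤ b)
    (hbc : b ≤ c) {ξ Φ : ℝ → EuclideanSpace ℝ (Fin d)}
    (h1 : Seg D a b ξ Φ) (h2 : Seg D b c ξ Φ) : Seg D a c ξ Φ := by
  obtain ⟨nv, μ, hnv, hcone, hμ, hI, hInteg⟩ := h1.lt
  obtain ⟨nv', μ', hnv', hcone', hμ', hI', hInteg'⟩ := h2.lt
  have hU : Set.Icc a c = Set.Icc a b ∪ Set.Icc b c := (Set.Icc_union_Icc_eq_Icc hab hbc).symm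
  have hbv := bv_Icc_union hab hbc h1.bv h2.bv
  refine ⟨?_, ?_, ?_, hbv, fun s => if s ≤ b then nv s else nv' s,
    μ.restrict (Set.Ioc a b) + μ'.restrict (Set.Ioc b c), ?_, ?_, ?_, ?_⟩
  · rw [hU]; exact h1.xc.union_of_isClosed h2.xc isClosed_Icc isClosed_Icc
  · intro t ht; rw [hU] at ht
    exact ht.elim (h1.xm t) (h2.xm t)
  · rw [hU]; exact h1.pc.union_of_isClosed h2.pc isClosed_Icc isClosed_Icc
  · exact Measurable.ite measurableSet_Iic hnv hnv'
  · intro s hs hx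
    by_cases hsb : s ≤ b
    · simp only [hsb, if_true]; exact hcone s ⟨hs.1, hsb⟩ hx
    · simp only [hsb, if_false]; exact hcone' s ⟨(not_le.1 hsb).le, hs.2⟩ hx
  · intro u v hu huv hv
    rw [Measure.add_apply, Measure.restrict_apply measurableSet_Ioc,
      Measure.restrict_apply measurableSet_Ioc, Set.Ioc_inter_Ioc, Set.Ioc_inter_Ioc]
    rw [max_eq_left hu, min_eq_left hv]
    rcases le_total v b with hvb | hvb
    · rw [min_eq_left hvb, hμ u v hu huv hvb, Set.Ioc_eq_empty_of_le (le_max_of_le_right hvb)]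
      simp
    · rcases le_total b u with hbu | hbu
      · rw [min_eq_right hvb, max_eq_left hbu, Set.Ioc_eq_empty_of_le hbu, hμ' u v hbu huv hv]
        simp
      · rw [min_eq_right hvb, max_eq_right hbu, hμ u b hu hbu le_rfl, hμ' b v le_rfl hvb hv,
          totalVar_add hbu hvb, ENNReal.ofReal_add (totalVar_nonneg _ _ _) (totalVar_nonneg _ _ _)]
        · exact h1.bv.mono (Set.Icc_subset_Icc_left hu)
        · exact h2.bv.mono (Set.Icc_subset_Icc_right hv)
  · set f : ℝ → EuclideanSpace ℝ (Fin d) :=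
      fun s => (frontier D).indicator (fun _ => (1 : ℝ)) (ξ s) • nv s with hf
    set f' : ℝ → EuclideanSpace ℝ (Fin d) :=
      fun s => (frontier D).indicator (fun _ => (1 : ℝ)) (ξ s) • nv' s with hf'
    set g : ℝ → EuclideanSpace ℝ (Fin d) :=
      fun s => (frontier D).indicator (fun _ => (1 : ℝ)) (ξ s) •
        (if s ≤ b then nv s else nv' s) with hg
    have e1 : Set.EqOn f g (Set.Ioc a b) := by
      intro s hs; simp [hf, hg, hs.2]
    have e2 : Set.EqOn f' g (Set.Ioc b c) := by
      intro s hs; simp [hf', hg, not_le.2 hs.1]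
    have i1 : IntegrableOn g (Set.Ioc a b) μ := hI.congr_fun e1 measurableSet_Ioc
    have i2 : IntegrableOn g (Set.Ioc b c) μ' := hI'.congr_fun e2 measurableSet_Ioc
    have j1 : Integrable g (μ.restrict (Set.Ioc a b) + μ'.restrict (Set.Ioc b c)) :=
      Integrable.add_measure i1 i2
    refine ⟨j1.integrableOn, ?_⟩
    intro t ht
    rw [Measure.restrict_add, integral_add_measure
      (Integrable.mono_measure i1 Measure.restrict_le_self)
      (Integrable.mono_measure i2 Measure.restrict_le_self),
      Measure.restrict_restrict measurableSet_Ioc, Measure.restrict_restrict measurableSet_Ioc,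
      Set.Ioc_inter_Ioc, Set.Ioc_inter_Ioc, max_self, max_eq_right hab, min_eq_left ht.2]
    rcases le_total t b with htb | htb
    · rw [min_eq_left htb, Set.Ioc_eq_empty_of_le htb, hInteg t ⟨ht.1, htb⟩]
      simp only [Measure.restrict_empty, integral_zero_measure, add_zero]
      exact setIntegral_congr_fun measurableSet_Ioc
        (e1.mono (Set.Ioc_subset_Ioc_right htb))
    · rw [min_eq_right htb, ← setIntegral_congr_fun measurableSet_Ioc e1,
        ← setIntegral_congr_fun measurableSet_Ioc
        (e2.mono (Set.Ioc_subset_Ioc_right ht.2)), ← hInteg b ⟨hab, le_rfl⟩, ← hInteg' t ⟨htb, ht.2⟩]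
      abel

lemma Seg.restrict_right {d : ℕ} {D : Set (EuclideanSpace ℝ (Fin d))} {a b c : ℝ}
    (hbc : b ≤ c) {ξ Φ : ℝ → EuclideanSpace ℝ (Fin d)}
    (h : Seg D a c ξ Φ) : Seg D a b ξ Φ := by
  obtain ⟨nv, μ, hnv, hcone, hμ, hI, hInteg⟩ := h.lt
  have hs : Set.Icc a b ⊆ Set.Icc a c := Set.Icc_subset_Icc_right hbc
  exact ⟨h.xc.mono hs, fun t ht => h.xm t (hs ht), h.pc.mono hs, h.bv.mono hs, nv, μ, hnv,
    fun s h' => hcone s (hs h'), fun u v hu huv hv => hμ u v hu huv (hv.trans hbc),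
    hI.mono_set (Set.Ioc_subset_Ioc_right hbc), fun t ht => hInteg t (hs ht)⟩

/-- Clamping to `[a,b]`. -/
def cl (a b u : ℝ) : ℝ := max a (min u b)

lemma cl_cont (a b : ℝ) : Continuous (cl a b) := by unfold cl; fun_prop

lemma cl_mono (a b : ℝ) : Monotone (cl a b) := by
  intro u v h; unfold cl; gcongr

lemma cl_mem {a b : ℝ} (hab : a ≤ b) (u : ℝ) : cl a b u ∈ Set.Icc a b :=
  ⟨le_max_left _ _, max_le hab (min_le_right _ _)⟩

lemma cl_eq {a b u : ℝ} (hu : u ∈ Set.Icc a b) : cl a b u = u := by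
  unfold cl; rw [min_eq_left hu.2, max_eq_right hu.1]

lemma totalVar_cl {d : ℕ} (Φ : ℝ → EuclideanSpace ℝ (Fin d)) (a b : ℝ) {u v : ℝ} (huv : u ≤ v) :
    eVariationOn (fun s => Φ (cl a b s)) (Set.Icc u v) =
      eVariationOn Φ (Set.Icc (cl a b u) (cl a b v)) := by
  have h := eVariationOn.comp_eq_of_monotoneOn Φ (cl a b) ((cl_mono a b).monotoneOn (Set.Icc u v))
  have h2 : cl a b '' Set.Icc u v = Set.Icc (cl a b u) (cl a b v) := by
    apply Set.Subset.antisymm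
    · rintro _ ⟨s, hs, rfl⟩
      exact ⟨cl_mono a b hs.1, cl_mono a b hs.2⟩
    · exact intermediate_value_Icc huv (cl_cont a b).continuousOn
  rw [← h2, ← h]; rfl

lemma Seg.clamped {d : ℕ} {D : Set (EuclideanSpace ℝ (Fin d))} {a b T : ℝ} (ha : 0 ≤ a)
    (hab : a ≤ b) {ξ Φ : ℝ → EuclideanSpace ℝ (Fin d)}
    (h : Seg D a b ξ Φ) :
    SkorohodSol D 0 T (fun u => ξ (cl a b u) - (Φ (cl a b u) - Φ a)) (fun u => ξ (cl a b u))
      (fun u => Φ (cl a b u) - Φ a) := by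
  obtain ⟨nv, μ, hnv, hcone, hμ, hI, hInteg⟩ := h.lt
  have cm : ∀ S : Set ℝ, MapsTo (cl a b) S (Set.Icc a b) := fun S u _ => cl_mem hab u
  refine ⟨h.xc.comp (cl_cont a b).continuousOn (cm _), fun t _ => h.xm _ (cl_mem hab t),
    (h.pc.comp (cl_cont a b).continuousOn (cm _)).sub continuousOn_const, ?_, ?_, ?_, ?_⟩
  · unfold BoundedVariationOn
    rw [eVar_sub_const (fun u => Φ (cl a b u))]
    exact ne_top_of_le_ne_top h.bv
      (eVariationOn.comp_le_of_monotoneOn Φ (cl a b) ((cl_mono a b).monotoneOn _) (cm _))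
  · have : cl a b 0 = a := by
      unfold cl; exact max_eq_left ((min_le_left _ _).trans ha)
    simp [this]
  · intro t _; simp
  · refine ⟨fun s => nv (cl a b s), μ.restrict (Set.Ioc a b), hnv.comp (cl_cont a b).measurable,
      fun s _ hs => hcone _ (cl_mem hab s) hs, ?_, ?_⟩
    · intro u v hu huv hv
      rw [totalVar_sub_const (fun u => Φ (cl a b u))]
      unfold totalVar
      rw [totalVar_cl Φ a b huv, Measure.restrict_apply measurableSet_Ioc]
      have hset : Set.Ioc u v ∩ Set.Ioc a b = Set.Ioc (cl a b u) (cl a b v) := by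
        ext s
        simp only [cl, Set.mem_inter_iff, Set.mem_Ioc, max_lt_iff, min_lt_iff, le_max_iff,
          le_min_iff]
        grind
      rw [hset, hμ _ _ (cl_mem hab u).1 (cl_mono a b huv) (cl_mem hab v).2]
      rfl
    · intro t ht
      have hset : Set.Icc 0 t ∩ Set.Ioc a b = Set.Ioc a (cl a b t) := by
        ext s
        simp only [cl, Set.mem_inter_iff, Set.mem_Ioc, Set.mem_Icc, le_max_iff,
          le_min_iff]
        grind
      rw [Measure.restrict_restrict measurableSet_Icc, hset, hInteg _ (cl_mem hab t)]
      refine setIntegral_congr_fun measurableSet_Ioc ?_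
      intro s hs
      have : cl a b s = s := cl_eq ⟨hs.1.le, hs.2.trans (cl_mem hab t).2⟩
      simp only [this]

lemma Seg.key {d : ℕ} {D : Set (EuclideanSpace ℝ (Fin d))} {a b T p C₀ K : ℝ} (ha : 0 ≤ a)
    (hab : a ≤ b) (hbT : b ≤ T) (hp : 1 ≤ p) (hK : 0 ≤ K)
    {ξ Φ : ℝ → EuclideanSpace ℝ (Fin d)}
    (h : Seg D a b ξ Φ) (hC : IsLocalTimeConst D T p C₀) {ω : ℝ → ℝ → ℝ} (hω : IsControl T ω)
    (hpos : ∀ s t, 0 ≤ s → s ≤ t → t ≤ T → 0 ≤ ω s t)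
    (hw : ∀ u v, a ≤ u → u ≤ v → v ≤ b →
      ‖(ξ v - Φ v) - (ξ u - Φ u)‖ ≤ K * ω u v ^ (1 / p)) {s t : ℝ}
    (hs : a ≤ s) (hst : s ≤ t) (ht : t ≤ b) :
    totalVar Φ s t ≤ C₀ * (K ^ p * ω s t + 1) * (Real.exp (C₀ * (K * ω s t ^ (1 / p))) + 1) *
      (K * ω s t ^ (1 / p)) := by
  have hp0 : (0:ℝ) < p := by linarith
  have hKp : 0 ≤ K ^ p := Real.rpow_nonneg hK p
  have hroot : ∀ u v, 0 ≤ u → u ≤ v → v ≤ T →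
      (K ^ p * ω u v) ^ (1 / p) = K * ω u v ^ (1 / p) := by
    intro u v h0 h1 h2
    rw [Real.mul_rpow hKp (hpos u v h0 h1 h2), one_div, Real.rpow_rpow_inv hK hp0.ne']
  have hctl : IsControl T (fun u v => K ^ p * ω (cl a b u) (cl a b v)) := by
    refine ⟨?_, ?_, ?_⟩
    · refine continuousOn_const.mul ?_
      have hc : Continuous (fun q : ℝ × ℝ => (cl a b q.1, cl a b q.2)) :=
        ((cl_cont a b).comp continuous_fst).prodMk ((cl_cont a b).comp continuous_snd)
      refine hω.cont.comp hc.continuousOn ?_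
      rintro ⟨u, v⟩ ⟨_, h2, _⟩
      exact ⟨ha.trans (cl_mem hab u).1, cl_mono a b h2, (cl_mem hab v).2.trans hbT⟩
    · intro u _ _
      rw [hω.diag _ (ha.trans (cl_mem hab u).1) ((cl_mem hab u).2.trans hbT), mul_zero]
    · intro u v w _ h1 h2 _
      rw [← mul_add]
      exact mul_le_mul_of_nonneg_left (hω.superadd _ _ _ (ha.trans (cl_mem hab u).1)
        (cl_mono a b h1) (cl_mono a b h2) ((cl_mem hab w).2.trans hbT)) hKp
  have hsol := h.clamped (T := T) ha hab
  have hmain := hC.2 _ hctl _ _ _ ?_ ?_ hsol s t (ha.trans hs) hst (ht.trans hbT)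
  · rw [totalVar_sub_const (fun u => Φ (cl a b u))] at hmain
    unfold totalVar at hmain ⊢
    rw [totalVar_cl Φ a b hst] at hmain
    rw [cl_eq ⟨hs, hst.trans ht⟩, cl_eq ⟨hs.trans hst, ht⟩,
      hroot s t (ha.trans hs) hst (ht.trans hbT)] at hmain
    exact hmain
  · exact hsol.xi_cont.sub hsol.phi_cont
  · intro u v _ huv _
    have hu := cl_mem hab u
    have hv := cl_mem hab v
    rw [hroot _ _ (ha.trans hu.1) (cl_mono a b huv) (hv.2.trans hbT)]
    have := hw _ _ hu.1 (cl_mono a b huv) hv.2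
    refine le_trans (le_of_eq ?_) this
    congr 1
    abel

/-! ### Constants -/

lemma sigma_facts {d n : ℕ}
    (σ : EuclideanSpace ℝ (Fin d) → EuclideanSpace ℝ (Fin n) →L[ℝ] EuclideanSpace ℝ (Fin d))
    (hσ : IsC1b σ) : (∀ y, ‖σ y‖ ≤ sigmaSup σ) ∧
      (∀ y z, ‖σ y - σ z‖ ≤ sigmaDerivSup σ * ‖y - z‖) ∧ 0 ≤ sigmaSup σ ∧ 0 ≤ sigmaDerivSup σ ∧
      (sigmaSup σ = 0 → sigmaDerivSup σ = 0) := by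
  obtain ⟨hc, ⟨K, hK⟩, ⟨K', hK'⟩⟩ := hσ
  have b1 : ∀ y, ‖σ y‖ ≤ sigmaSup σ := fun y =>
    le_ciSup (f := fun y => ‖σ y‖) ⟨K, by rintro _ ⟨y, rfl⟩; exact hK y⟩ y
  have b2 : ∀ y, ‖fderiv ℝ σ y‖ ≤ sigmaDerivSup σ := fun y =>
    le_ciSup (f := fun y => ‖fderiv ℝ σ y‖) ⟨K', by rintro _ ⟨y, rfl⟩; exact hK' y⟩ y
  refine ⟨b1, ?_, (norm_nonneg _).trans (b1 0), (norm_nonneg (fderiv ℝ σ 0)).trans (b2 0), ?_⟩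
  · intro y z
    exact convex_univ.norm_image_sub_le_of_norm_fderiv_le
      (fun x _ => (hc.differentiable one_ne_zero) x) (fun x _ => b2 x) (mem_univ z) (mem_univ y)
  · intro h0
    have hz : σ = fun _ => 0 := by
      funext y
      have := b1 y
      rw [h0] at this
      exact norm_le_zero_iff.1 this
    unfold sigmaDerivSup
    rw [hz]
    simp
    exact norm_zero (E := EuclideanSpace ℝ (Fin d) →L[ℝ] EuclideanSpace ℝ (Fin n) →L[ℝ]
      EuclideanSpace ℝ (Fin d))

/-- Numerical properties of the admissible threshold `ε`. -/
structure GoodEps (p γ C₀ S L C₂ M ε : ℝ) : Prop where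
  H1 : ∀ r, 0 ≤ r → r ≤ ε → M * r ^ (γ / p) ≤ S / 20 * r ^ (1 / p)
  H2 : ∀ r, 0 ≤ r → r ≤ ε → M * r ^ (γ / p) ≤ r ^ (1 / p)
  H3 : ∀ r, 0 ≤ r → r ≤ ε → C₂ * L * r ^ (1 / p) ≤ S / 20
  H4 : ∀ r, 0 ≤ r → r ≤ ε → r ^ (1 / p) * r ^ (1 / p) ≤ r ^ (γ / p)
  H5 : ∀ r, 0 ≤ r → 2 * (M * (r / 2) ^ (γ / p)) + 2 * C₂ * L * r ^ (γ / p) = M * r ^ (γ / p)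
  H6 : ∀ r, 0 ≤ r → r ≤ ε → C₀ * ((11 / 10 * S) ^ p * r + 1) *
      (Real.exp (C₀ * ((11 / 10 * S) * r ^ (1 / p))) + 1) * ((11 / 10 * S) * r ^ (1 / p)) ≤
      3 * C₀ * S * r ^ (1 / p)

lemma small_rpow {a c A : ℝ} (ha : 0 < a) (hA : 0 < A) :
    ∀ᶠ e in nhdsWithin (0:ℝ) (Set.Ioi 0), c * e ^ a < A := by
  have h : ContinuousAt (fun e : ℝ => c * e ^ a) 0 :=
    continuousAt_const.mul (Real.continuousAt_rpow_const 0 a (Or.inr ha.le))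
  have h2 := h.tendsto
  simp only [Real.zero_rpow ha.ne', mul_zero] at h2
  exact (h2.eventually_lt_const hA).filter_mono nhdsWithin_le_nhds

lemma exists_eps {p γ C₀ S L C₂ M : ℝ} (hp : 1 ≤ p) (hpγ : p < γ) (hγ : γ ≤ 2) (hC₀ : 1 < C₀)
    (hS : 0 ≤ S) (hL : 0 ≤ L) (hSL : S = 0 → L = 0) (hC₂ : C₂ = 1 + 4 * C₀ * S)
    (hM : M = 2 * C₂ * L / (1 - 2 ^ ((1 : ℝ) - γ / p))) :
    ∃ ε : ℝ, 0 < ε ∧ ε ≤ 1 ∧ GoodEps p γ C₀ S L C₂ M ε ∧ 0 ≤ M := by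
  have hp0 : 0 < p := by linarith
  have hC₂1 : 1 ≤ C₂ := by rw [hC₂]; nlinarith [mul_nonneg (by linarith : 0 ≤ C₀) hS]
  have hx : (1:ℝ) - γ / p < 0 := by
    have : 1 < γ / p := by rw [lt_div_iff₀ hp0]; linarith
    linarith
  set Q : ℝ := 2 ^ ((1 : ℝ) - γ / p) with hQ
  have hQ1 : Q < 1 := Real.rpow_lt_one_of_one_lt_of_neg (by norm_num) hx
  have hQ0 : 0 < Q := Real.rpow_pos_of_pos (by norm_num) _
  have hMq : M * (1 - Q) = 2 * C₂ * L := by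
    rw [hM]; field_simp [show (1 - Q) ≠ 0 by linarith]
  have hCL : 0 ≤ C₂ * L := by positivity
  have hM0 : 0 ≤ M := by
    rw [hM]; exact div_nonneg (by linarith) (by linarith)
  have hMge : 2 * C₂ * L ≤ M := by nlinarith
  have hg0 : 0 < (γ - 1) / p := div_pos (by linarith) hp0
  have hp1 : 0 < 1 / p := by positivity
  have E1 : ∀ᶠ e in nhdsWithin (0:ℝ) (Set.Ioi 0), M * e ^ ((γ - 1) / p) ≤ S / 20 := by
    rcases hS.eq_or_lt with h0 | h0
    · have : M = 0 := by rw [hM, hSL h0.symm]; simp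
      refine Filter.Eventually.of_forall fun e => ?_
      rw [this, ← h0]; simp
    · exact (small_rpow hg0 (by positivity)).mono fun e h => h.le
  have E2 := small_rpow (c := M) hg0 one_pos
  have E3 := small_rpow (c := (11 / 10 * S) ^ p) one_pos (show (0:ℝ) < 1 / 10 by norm_num)
  have E4 := small_rpow (c := C₀ * (11 / 10 * S)) hp1 (show (0:ℝ) < 1 / 4 by norm_num)
  have E5 : ∀ᶠ e in nhdsWithin (0:ℝ) (Set.Ioi 0), e ≤ 1 :=
    (eventually_le_nhds one_pos).filter_mono nhdsWithin_le_nhds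
  obtain ⟨ε, h1, h2, h3, h4, h5, hpos⟩ :=
    (E1.and (E2.and (E3.and (E4.and (E5.and self_mem_nhdsWithin))))).exists
  have hpos : 0 < ε := hpos
  refine ⟨ε, hpos, h5, ?_, hM0⟩
  have hsplit : ∀ r : ℝ, 0 ≤ r → r ^ (γ / p) = r ^ ((γ - 1) / p) * r ^ (1 / p) := by
    intro r hr
    rw [← Real.rpow_add_of_nonneg hr hg0.le hp1.le]
    congr 1; ring
  have hmon : ∀ r : ℝ, 0 ≤ r → r ≤ ε → M * r ^ ((γ - 1) / p) ≤ M * ε ^ ((γ - 1) / p) := by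
    intro r hr hre
    exact mul_le_mul_of_nonneg_left (Real.rpow_le_rpow hr hre hg0.le) hM0
  refine ⟨?_, ?_, ?_, ?_, ?_, ?_⟩
  · intro r hr hre
    rw [hsplit r hr, ← mul_assoc]
    exact mul_le_mul_of_nonneg_right ((hmon r hr hre).trans h1) (Real.rpow_nonneg hr _)
  · intro r hr hre
    rw [hsplit r hr, ← mul_assoc]
    have := mul_le_mul_of_nonneg_right ((hmon r hr hre).trans h2.le) (Real.rpow_nonneg hr (1 / p))
    linarith
  · intro r hr hre
    rcases hr.eq_or_lt with h0 | h0
    · rw [← h0, Real.zero_rpow hp1.ne']; simp; positivity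
    have e1 : r ^ (1 / p) ≤ r ^ ((γ - 1) / p) := by
      apply Real.rpow_le_rpow_of_exponent_ge h0 (hre.trans h5)
      gcongr; linarith
    have e2 : 0 ≤ r ^ ((γ - 1) / p) := Real.rpow_nonneg hr _
    calc C₂ * L * r ^ (1 / p) ≤ M * r ^ ((γ - 1) / p) := by
          apply mul_le_mul _ e1 (Real.rpow_nonneg hr _) hM0
          nlinarith
      _ ≤ S / 20 := (hmon r hr hre).trans h1
  · intro r hr hre
    rcases hr.eq_or_lt with h0 | h0
    · rw [← h0, Real.zero_rpow hp1.ne', Real.zero_rpow (div_pos (by linarith) hp0).ne']; simp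
    rw [← Real.rpow_add h0]
    apply Real.rpow_le_rpow_of_exponent_ge h0 (hre.trans h5)
    rw [← add_div]; gcongr; linarith
  · intro r hr
    have hγp : (2:ℝ) * (r / 2) ^ (γ / p) = Q * r ^ (γ / p) := by
      rw [Real.div_rpow hr (by norm_num), hQ, Real.rpow_sub (by norm_num), Real.rpow_one]
      ring
    have : 2 * (M * (r / 2) ^ (γ / p)) = M * (Q * r ^ (γ / p)) := by rw [← hγp]; ring
    rw [this, ← hMq]; ring
  · intro r hr hre
    set K := 11 / 10 * S with hKd
    have hK : 0 ≤ K := by positivity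
    have hR : 0 ≤ r ^ (1 / p) := Real.rpow_nonneg hr _
    have a1 : K ^ p * r ≤ 1 / 10 := by
      rw [Real.rpow_one] at h3
      exact (mul_le_mul_of_nonneg_left hre (Real.rpow_nonneg hK p)).trans h3.le
    have a0 : 0 ≤ K ^ p * r := mul_nonneg (Real.rpow_nonneg hK p) hr
    have a2 : C₀ * (K * r ^ (1 / p)) ≤ 1 / 4 := by
      have : r ^ (1 / p) ≤ ε ^ (1 / p) := Real.rpow_le_rpow hr hre hp1.le
      have := mul_le_mul_of_nonneg_left this (by positivity : 0 ≤ C₀ * K)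
      linarith
    have a3 : Real.exp (C₀ * (K * r ^ (1 / p))) ≤ 14 / 10 := by
      have a30 : 0 ≤ C₀ * (K * r ^ (1 / p)) := by positivity
      have := Real.exp_bound_div_one_sub_of_interval a30 (by linarith)
      refine this.trans ?_
      rw [div_le_iff₀ (by linarith)]
      linarith
    have hC0 : 0 ≤ C₀ := by linarith
    have hE := Real.exp_pos (C₀ * (K * r ^ (1 / p)))
    calc _ ≤ C₀ * (1 / 10 + 1) * (14 / 10 + 1) * (K * r ^ (1 / p)) := by gcongr
      _ ≤ _ := by
        rw [hKd]
        have : 0 ≤ C₀ * S * r ^ (1 / p) := by positivity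
        nlinarith

/-! ### The core induction -/

lemma core {d n : ℕ}
    {σ : EuclideanSpace ℝ (Fin d) → EuclideanSpace ℝ (Fin n) →L[ℝ] EuclideanSpace ℝ (Fin d)}
    {p γ C₀ S L C₁ C₂ M ε T : ℝ} (hp : 1 ≤ p) (hC₀ : 1 < C₀) (hS : 0 ≤ S) (hL : 0 ≤ L)
    (hM : 0 ≤ M) (hγp : 0 < γ / p)
    (hC₁ : C₁ = 3 * C₀ * S) (hC₂ : C₂ = 1 + 4 * C₀ * S)
    (G : GoodEps p γ C₀ S L C₂ M ε)
    (hσ : ∀ y, ‖σ y‖ ≤ S) (hDσ : ∀ y z, ‖σ y - σ z‖ ≤ L * ‖y - z‖)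
    {D : Set (EuclideanSpace ℝ (Fin d))} (hC : IsLocalTimeConst D T p C₀)
    {ω : ℝ → ℝ → ℝ} (hω : IsControl T ω)
    (hpos : ∀ s t, 0 ≤ s → s ≤ t → t ≤ T → 0 ≤ ω s t)
    {x : ℝ → EuclideanSpace ℝ (Fin n)}
    (hx : ∀ s t, 0 ≤ s → s ≤ t → t ≤ T → ‖x t - x s‖ ≤ ω s t ^ (1 / p))
    {N : ℕ} {τ : ℕ → ℝ} (hτ : Monotone τ) (hτ0 : τ 0 = 0) (hτN : ∀ i, τ i ≤ T)
    {y Φ : ℝ → EuclideanSpace ℝ (Fin d)}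
    (hseg : ∀ i < N, Seg D (τ i) (τ (i + 1)) y Φ)
    (heq : ∀ i < N, ∀ u ∈ Set.Icc (τ i) (τ (i + 1)),
      y u = y (τ i) + σ (y (τ i)) (x u - x (τ i)) + (Φ u - Φ (τ i))) :
    ∀ m j : ℕ, j + m ≤ N → ∀ t, τ j ≤ t → t ≤ τ (j + m) → ω (τ j) t ≤ ε →
      ‖y t - y (τ j) - σ (y (τ j)) (x t - x (τ j)) - (Φ t - Φ (τ j))‖ ≤
        M * ω (τ j) t ^ (γ / p) ∧
      ∀ s, τ j ≤ s → s ≤ t → totalVar Φ s t ≤ C₁ * ω s t ^ (1 / p) := by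
  have hp0 : 0 < p := by linarith
  have hp1 : 0 < 1 / p := by positivity
  have hτp : ∀ i, 0 ≤ τ i := fun i => hτ0 ▸ hτ (Nat.zero_le i)
  -- monotonicity of the control
  have mono : ∀ s s' t' t, 0 ≤ s → s ≤ s' → s' ≤ t' → t' ≤ t → t ≤ T → ω s' t' ≤ ω s t := by
    intro s s' t' t h0 h1 h2 h3 h4
    have e1 := hω.superadd s s' t h0 h1 (h2.trans h3) h4
    have e2 := hω.superadd s' t' t (h0.trans h1) h2 h3 h4
    have e3 := hpos s s' h0 h1 ((h2.trans h3).trans h4)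
    have e4 := hpos t' t (h0.trans (h1.trans h2)) h3 h4
    linarith
  have monoR : ∀ s s' t' t, 0 ≤ s → s ≤ s' → s' ≤ t' → t' ≤ t → t ≤ T →
      ω s' t' ^ (1 / p) ≤ ω s t ^ (1 / p) := by
    intro s s' t' t h0 h1 h2 h3 h4
    exact Real.rpow_le_rpow (hpos _ _ (h0.trans h1) h2 (h3.trans h4))
      (mono s s' t' t h0 h1 h2 h3 h4) hp1.le
  -- long segments
  have hlong : ∀ m j : ℕ, j + m + 1 ≤ N → Seg D (τ j) (τ (j + (m + 1))) y Φ := by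
    intro m
    induction m with
    | zero => intro j hj; exact hseg j (by omega)
    | succ m ih =>
      intro j hj
      exact (ih j (by omega)).concat (hτ (by omega)) (hτ (by omega)) (hseg (j + (m + 1)) (by omega))
  have hC₂0 : 0 ≤ C₂ := by rw [hC₂]; positivity
  -- increments of `y`
  have incr : ∀ m j : ℕ, j + m ≤ N → ∀ t, τ j ≤ t → t ≤ τ (j + m) → ω (τ j) t ≤ ε →
      (‖y t - y (τ j) - σ (y (τ j)) (x t - x (τ j)) - (Φ t - Φ (τ j))‖ ≤
        M * ω (τ j) t ^ (γ / p) ∧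
      ∀ s, τ j ≤ s → s ≤ t → totalVar Φ s t ≤ C₁ * ω s t ^ (1 / p)) →
      ‖y t - y (τ j)‖ ≤ C₂ * ω (τ j) t ^ (1 / p) := by
    intro m j hj t h1 h2 h3 ⟨h4, h5⟩
    have htT : t ≤ T := h2.trans (hτN _)
    have hr := hpos _ _ (hτp j) h1 htT
    have hR : 0 ≤ ω (τ j) t ^ (1 / p) := Real.rpow_nonneg hr _
    have hbv : BoundedVariationOn Φ (Set.Icc (τ j) t) := by
      rcases m with _ | m
      · have : t = τ j := le_antisymm h2 h1
        rw [this, Set.Icc_self]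
        unfold BoundedVariationOn
        rw [eVariationOn.subsingleton _ Set.subsingleton_singleton]
        simp
      · exact (hlong m j (by omega)).bv.mono (Set.Icc_subset_Icc_right h2)
    have a1 := (norm_sub_le_totalVar h1 hbv).trans (h5 _ le_rfl h1)
    have a2 : ‖σ (y (τ j)) (x t - x (τ j))‖ ≤ S * ω (τ j) t ^ (1 / p) :=
      (ContinuousLinearMap.le_opNorm _ _).trans
        (mul_le_mul (hσ _) (hx _ _ (hτp j) h1 htT) (norm_nonneg _) hS)
    have a3 := h4.trans (G.H2 _ hr h3)
    have : y t - y (τ j) = (y t - y (τ j) - σ (y (τ j)) (x t - x (τ j)) - (Φ t - Φ (τ j))) +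
        σ (y (τ j)) (x t - x (τ j)) + (Φ t - Φ (τ j)) := by abel
    rw [this]
    refine (norm_add₃_le).trans ?_
    rw [hC₂]; rw [hC₁] at a1
    nlinarith [mul_nonneg (mul_nonneg hS hR) (by linarith : 0 ≤ C₀ - 1)]
  intro m
  induction m using Nat.strong_induction_on with
  | _ m ih =>
  intro j hj t htl htu hte
  have htT : t ≤ T := htu.trans (hτN _)
  rcases m with _ | m
  · have : t = τ j := le_antisymm htu htl
    subst this
    have hd := hω.diag (τ j) (hτp j) (hτN j)
    refine ⟨?_, ?_⟩
    · simp only [sub_self, map_zero, norm_zero, hd]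
      rw [Real.zero_rpow hγp.ne', mul_zero]
    · intro s h1 h2
      have : s = τ j := le_antisymm h2 h1
      subst this
      rw [hd, Real.zero_rpow hp1.ne', mul_zero]
      unfold totalVar
      rw [Set.Icc_self, eVariationOn.subsingleton _ Set.subsingleton_singleton]
      simp
  -- the case where an earlier level applies
  by_cases htm : t ≤ τ (j + m)
  · exact ih m (by omega) j (by omega) t htl htm hte
  push Not at htm
  have hr := hpos _ _ (hτp j) htl htT
  set r := ω (τ j) t with hrdef
  have hRg : 0 ≤ r ^ (γ / p) := Real.rpow_nonneg hr _
  -- error terms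
  have err : ∀ i u : ℕ, j ≤ i → i ≤ u → u ≤ j + m → u - i < m + 1 →
      ‖(σ (y (τ u)) - σ (y (τ i))) (x t - x (τ u))‖ ≤ C₂ * L * r ^ (γ / p) := by
    intro i u hji hiu hum hlt
    have hut : τ u ≤ t := (hτ hum).trans htm.le
    have hiut : τ i ≤ τ u := hτ hiu
    have hle : ω (τ i) (τ u) ≤ r := mono _ _ _ _ (hτp j) (hτ hji) hiut hut htT
    have hui : i + (u - i) = u := by omega
    have h1 := incr (u - i) i (by omega) (τ u) hiut (by rw [hui]) (hle.trans hte)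
      (ih (u - i) hlt i (by omega) (τ u) hiut (by rw [hui]) (hle.trans hte))
    have hR : 0 ≤ r ^ (1 / p) := Real.rpow_nonneg hr _
    have h2 : ‖y (τ u) - y (τ i)‖ ≤ C₂ * r ^ (1 / p) :=
      h1.trans (mul_le_mul_of_nonneg_left
        (monoR _ _ _ _ (hτp j) (hτ hji) hiut hut htT) hC₂0)
    have h3 : ‖x t - x (τ u)‖ ≤ r ^ (1 / p) :=
      (hx _ _ (hτp u) hut htT).trans
        (monoR _ _ _ _ (hτp j) (hτ (hji.trans hiu)) hut le_rfl htT)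
    calc _ ≤ ‖σ (y (τ u)) - σ (y (τ i))‖ * ‖x t - x (τ u)‖ := ContinuousLinearMap.le_opNorm _ _
      _ ≤ (L * (C₂ * r ^ (1 / p))) * r ^ (1 / p) := by
        apply mul_le_mul _ h3 (norm_nonneg _) (by positivity)
        exact (hDσ _ _).trans (mul_le_mul_of_nonneg_left h2 hL)
      _ = C₂ * L * (r ^ (1 / p) * r ^ (1 / p)) := by ring
      _ ≤ _ := mul_le_mul_of_nonneg_left (G.H4 r hr hte) (by positivity)
  have half : ∀ q, 0 ≤ q → q ≤ r / 2 → M * q ^ (γ / p) ≤ M * (r / 2) ^ (γ / p) := by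
    intro q h0 h1
    exact mul_le_mul_of_nonneg_left (Real.rpow_le_rpow h0 h1 hγp.le) hM
  have hhalf0 : 0 ≤ M * (r / 2) ^ (γ / p) := by positivity
  have hH5 := G.H5 r hr
  have hCL : 0 ≤ C₂ * L * r ^ (γ / p) := by positivity
  refine ⟨?_, ?_⟩
  · -- choice of the splitting point
    obtain ⟨l, hlm, hl1, hl2⟩ : ∃ l ≤ m, ω (τ j) (τ (j + l)) ≤ r / 2 ∧
        (l = m ∨ l < m ∧ r / 2 < ω (τ j) (τ (j + l + 1))) := by
      classical
      let P : ℕ → Prop := fun l => ω (τ j) (τ (j + l)) ≤ r / 2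
      have hP0 : P 0 := by
        change ω (τ j) (τ j) ≤ r / 2
        rw [hω.diag _ (hτp j) (hτN j)]; positivity
      refine ⟨Nat.findGreatest P m, Nat.findGreatest_le m,
        Nat.findGreatest_spec (P := P) (Nat.zero_le m) hP0, ?_⟩
      rcases (Nat.findGreatest_le (P := P) m).eq_or_lt with h | h
      · exact Or.inl h
      · refine Or.inr ⟨h, ?_⟩
        have := Nat.findGreatest_is_greatest (P := P) (Nat.lt_succ_self _) h
        exact not_le.1 this
    have hI1 := (ih l (by omega) j (by omega) (τ (j + l)) (hτ (by omega)) le_rfl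
      (hl1.trans (by linarith))).1
    have hI1' := hI1.trans (half _ (hpos _ _ (hτp j) (hτ (by omega)) (hτN _)) hl1)
    have hE1 := err j (j + l) le_rfl (by omega) (by omega) (by omega)
    rcases hl2 with rfl | ⟨hlm', hl2⟩
    · have he := heq (j + l) (by omega) t ⟨htm.le, by rw [add_assoc]; exact htu⟩
      have key : y t - y (τ j) - σ (y (τ j)) (x t - x (τ j)) - (Φ t - Φ (τ j)) =
          (y (τ (j + l)) - y (τ j) - σ (y (τ j)) (x (τ (j + l)) - x (τ j)) -
            (Φ (τ (j + l)) - Φ (τ j))) +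
          (σ (y (τ (j + l))) - σ (y (τ j))) (x t - x (τ (j + l))) := by
        rw [he]
        simp only [map_sub, _root_.sub_apply]
        abel
      rw [key]
      refine (norm_add_le _ _).trans ?_
      linarith
    · have hut : τ (j + l + 1) ≤ t := (hτ (by omega)).trans htm.le
      have hjm : j + l + 1 + (m - l) = j + (m + 1) := by omega
      have hw2 : ω (τ (j + l + 1)) t ≤ r / 2 := by
        have := hω.superadd (τ j) (τ (j + l + 1)) t (hτp j) (hτ (by omega)) hut htT
        rw [← hrdef] at this
        linarith
      have hI2 := (ih (m - l) (by omega) (j + l + 1) (by omega) t hut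
        (by rw [hjm]; exact htu) (hw2.trans (by linarith))).1
      have hI2' := hI2.trans (half _ (hpos _ _ (hτp _) hut htT) hw2)
      have hE2 := err (j + l) (j + l + 1) (by omega) (by omega) (by omega) (by omega)
      have he := heq (j + l) (by omega) (τ (j + l + 1)) ⟨hτ (by omega), le_rfl⟩
      have key : y t - y (τ j) - σ (y (τ j)) (x t - x (τ j)) - (Φ t - Φ (τ j)) =
          (y (τ (j + l)) - y (τ j) - σ (y (τ j)) (x (τ (j + l)) - x (τ j)) -
            (Φ (τ (j + l)) - Φ (τ j))) +
          (y t - y (τ (j + l + 1)) - σ (y (τ (j + l + 1))) (x t - x (τ (j + l + 1))) -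
            (Φ t - Φ (τ (j + l + 1)))) +
          (σ (y (τ (j + l))) - σ (y (τ j))) (x t - x (τ (j + l))) +
          (σ (y (τ (j + l + 1))) - σ (y (τ (j + l)))) (x t - x (τ (j + l + 1))) := by
        have he' : y (τ (j + l + 1)) - y (τ (j + l)) -
            σ (y (τ (j + l))) (x (τ (j + l + 1)) - x (τ (j + l))) -
            (Φ (τ (j + l + 1)) - Φ (τ (j + l))) = 0 := by
          rw [sub_sub, sub_sub, sub_eq_zero]
          exact he.trans (by abel)
        rw [← sub_eq_zero, ← he']
        simp only [map_sub, _root_.sub_apply]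
        abel
      rw [key]
      refine (norm_add_le _ _).trans ?_
      have := norm_add₃_le (a := (y (τ (j + l)) - y (τ j) - σ (y (τ j)) (x (τ (j + l)) - x (τ j)) -
            (Φ (τ (j + l)) - Φ (τ j)))) (b := (y t - y (τ (j + l + 1)) -
            σ (y (τ (j + l + 1))) (x t - x (τ (j + l + 1))) -
            (Φ t - Φ (τ (j + l + 1))))) (c := (σ (y (τ (j + l))) - σ (y (τ j)))
            (x t - x (τ (j + l))))
      linarith
  · -- the bound for the total variation
    intro s hs hst
    have hsegt : Seg D (τ j) t y Φ := (hlong m j (by omega)).restrict_right htu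
    have hw : ∀ u v, τ j ≤ u → u ≤ v → v ≤ t →
        ‖(y v - Φ v) - (y u - Φ u)‖ ≤ (11 / 10 * S) * ω u v ^ (1 / p) := by
      intro u v hu huv hv
      have hvT := hv.trans htT
      have hu0 := (hτp j).trans hu
      have hq := hpos u v hu0 huv hvT
      have hqr : ω u v ≤ r := mono _ _ _ _ (hτp j) hu huv hv htT
      have hQ : 0 ≤ ω u v ^ (1 / p) := Real.rpow_nonneg hq _
      have hxuv := hx u v hu0 huv hvT
      -- locate `u`
      obtain ⟨i, him, hiu, hui⟩ : ∃ i ≤ m, τ (j + i) ≤ u ∧ (u ≤ τ (j + i + 1)) := by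
        classical
        let P : ℕ → Prop := fun l => τ (j + l) ≤ u
        have hP0 : P 0 := hu
        refine ⟨Nat.findGreatest P m, Nat.findGreatest_le m,
          Nat.findGreatest_spec (P := P) (Nat.zero_le m) hP0, ?_⟩
        rcases (Nat.findGreatest_le (P := P) m).eq_or_lt with h | h
        · rw [h]; exact (huv.trans hv).trans htu
        · have := Nat.findGreatest_is_greatest (P := P) (Nat.lt_succ_self _) h
          exact (not_le.1 this).le
      have heu := heq (j + i) (by omega) u ⟨hiu, hui⟩
      have base : ∀ z, ‖σ z (x v - x u)‖ ≤ S * ω u v ^ (1 / p) := fun z =>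
        (ContinuousLinearMap.le_opNorm _ _).trans
          (mul_le_mul (hσ _) hxuv (norm_nonneg _) hS)
      by_cases hvi : v ≤ τ (j + i + 1)
      · have hev := heq (j + i) (by omega) v ⟨hiu.trans huv, hvi⟩
        have : (y v - Φ v) - (y u - Φ u) = σ (y (τ (j + i))) (x v - x u) := by
          rw [heu, hev]; simp only [map_sub]; abel
        rw [this]
        refine (base _).trans ?_
        nlinarith [mul_nonneg hS hQ]
      · push Not at hvi
        have him' : i < m := by
          rcases him.eq_or_lt with h | h
          · exfalso; rw [h] at hvi; exact absurd (hv.trans htu) (not_le.2 hvi)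
          · exact h
        have hji : τ j ≤ τ (j + i + 1) := hτ (by omega)
        have hjm : j + i + 1 + (m - i) = j + (m + 1) := by omega
        -- the term `I`
        have hwI : ω (τ (j + i + 1)) v ≤ ω u v := mono _ _ _ _ hu0 hui hvi.le le_rfl hvT
        have hI0 := hpos _ _ (hτp (j + i + 1)) hvi.le hvT
        have hI := (ih (m - i) (by omega) (j + i + 1) (by omega) v hvi.le
          (by rw [hjm]; exact hv.trans htu) ((hwI.trans hqr).trans hte)).1
        have hI' := hI.trans (G.H1 _ hI0 ((hwI.trans hqr).trans hte))
        have hI'' := hI'.trans (mul_le_mul_of_nonneg_left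
          (monoR _ _ _ _ hu0 hui hvi.le le_rfl hvT) (by positivity : 0 ≤ S / 20))
        -- one step increment
        have hst1 : τ (j + i) ≤ τ (j + i + 1) := hτ (by omega)
        have hw1 : ω (τ (j + i)) (τ (j + i + 1)) ≤ ε :=
          (mono _ _ _ _ (hτp j) (hτ (by omega)) hst1 (hvi.le.trans hv) htT).trans hte
        have h1 := incr 1 (j + i) (by omega) (τ (j + i + 1)) hst1 le_rfl hw1
          (ih 1 (by omega) (j + i) (by omega) (τ (j + i + 1)) hst1 le_rfl hw1)
        have hxx : ‖x (τ (j + i + 1)) - x u‖ ≤ ω u v ^ (1 / p) :=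
          (hx _ _ hu0 hui (hτN _)).trans (monoR _ _ _ _ hu0 le_rfl hui hvi.le hvT)
        have hE : ‖(σ (y (τ (j + i + 1))) - σ (y (τ (j + i)))) (x (τ (j + i + 1)) - x u)‖ ≤
            S / 20 * ω u v ^ (1 / p) := by
          refine (ContinuousLinearMap.le_opNorm _ _).trans ?_
          refine mul_le_mul ?_ hxx (norm_nonneg _) (by positivity)
          refine (hDσ _ _).trans ((mul_le_mul_of_nonneg_left h1 hL).trans ?_)
          have := G.H3 _ (hpos _ _ (hτp (j + i)) hst1 (hτN _)) hw1
          linarith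
        have hev := heq (j + i) (by omega) (τ (j + i + 1)) ⟨hst1, le_rfl⟩
        have key : (y v - Φ v) - (y u - Φ u) = σ (y (τ (j + i + 1))) (x v - x u) +
            (y v - y (τ (j + i + 1)) - σ (y (τ (j + i + 1))) (x v - x (τ (j + i + 1))) -
              (Φ v - Φ (τ (j + i + 1)))) -
            (σ (y (τ (j + i + 1))) - σ (y (τ (j + i)))) (x (τ (j + i + 1)) - x u) := by
          have he' : y (τ (j + i + 1)) - y (τ (j + i)) -
              σ (y (τ (j + i))) (x (τ (j + i + 1)) - x (τ (j + i))) -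
              (Φ (τ (j + i + 1)) - Φ (τ (j + i))) = 0 := by
            rw [sub_sub, sub_sub, sub_eq_zero]
            exact hev.trans (by abel)
          rw [heu, ← sub_eq_zero, ← he']
          simp only [map_sub, _root_.sub_apply]
          abel
        rw [key]
        refine (norm_sub_le _ _).trans ?_
        have a1 := norm_add_le (σ (y (τ (j + i + 1))) (x v - x u))
          (y v - y (τ (j + i + 1)) - σ (y (τ (j + i + 1))) (x v - x (τ (j + i + 1))) -
              (Φ v - Φ (τ (j + i + 1))))
        have a2 := base (y (τ (j + i + 1)))
        nlinarith [mul_nonneg hS hQ]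
    have := hsegt.key (hτp j) htl htT hp (by positivity) hC hω hpos hw hs hst le_rfl
    rw [hC₁]
    exact this.trans (G.H6 _ (hpos _ _ ((hτp j).trans hs) hst htT)
      ((mono _ _ _ _ (hτp j) hs hst le_rfl htT).trans hte))

/-- Lemma 3.2: local estimates for the Euler approximation of the
reflected Young differential equation.  The constant `ε` depends only on `‖σ‖_∞`,
`‖Dσ‖_∞` and `C₀` (hence it is uniform in `T`, `D`, `ω`, `x`, the partition and the
starting point). -/
theorem euler_local_estimate {d n : ℕ}
    (σ : EuclideanSpace ℝ (Fin d) → EuclideanSpace ℝ (Fin n) →L[ℝ] EuclideanSpace ℝ (Fin d))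
    (hσ : IsC1b σ) (p γ C₀ : ℝ) (hp : 1 ≤ p) (hpγ : p < γ) (hγ : γ ≤ 2) (hC₀ : 1 < C₀)
    (C₁ C₂ M : ℝ)
    (hC₁ : C₁ = 3 * C₀ * sigmaSup σ) (hC₂ : C₂ = 1 + 4 * C₀ * sigmaSup σ)
    (hM : M = 2 * C₂ * sigmaDerivSup σ / (1 - 2 ^ ((1 : ℝ) - γ / p))) :
    ∃ ε : ℝ, 0 < ε ∧ ε ≤ 1 ∧
      ∀ (T : ℝ) (D : Set (EuclideanSpace ℝ (Fin d))) (r₀ δ β : ℝ),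
        CondA D r₀ → CondB D δ β → IsLocalTimeConst D T p C₀ →
        ∀ ω : ℝ → ℝ → ℝ, IsControl T ω →
        ∀ x : ℝ → EuclideanSpace ℝ (Fin n),
          ContinuousOn x (Set.Icc 0 T) →
          (∀ s t, 0 ≤ s → s ≤ t → t ≤ T → ‖x t - x s‖ ≤ ω s t ^ (1 / p)) →
        ∀ (N : ℕ) (tt : Fin (N + 1) → ℝ), IsPartition T tt →
        ∀ (y Φ : ℝ → EuclideanSpace ℝ (Fin d)) (y₀ : EuclideanSpace ℝ (Fin d)),
          y₀ ∈ closure D → IsEulerApprox D σ x tt y Φ y₀ →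
        ∀ (k : Fin (N + 1)) (s t : ℝ), tt k ≤ s → s ≤ t → t ≤ T → ω (tt k) t ≤ ε →
          ‖y t - y (tt k) - σ (y (tt k)) (x t - x (tt k)) - (Φ t - Φ (tt k))‖ ≤
              M * ω (tt k) t ^ (γ / p) ∧
            totalVar Φ s t ≤ C₁ * ω s t ^ (1 / p) := by
  obtain ⟨f1, f2, f3, f4, f5⟩ := sigma_facts σ hσ
  obtain ⟨ε, hε0, hε1, G, hM0⟩ := exists_eps hp hpγ hγ hC₀ f3 f4 f5 hC₂ hM
  refine ⟨ε, hε0, hε1, ?_⟩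
  intro T D r₀ δ β _ _ hC ω hω x _ hx N tt htt y Φ y₀ _ hE k s t hks hst htT hte
  have hp0 : 0 < p := by linarith
  have hγp : 0 < γ / p := div_pos (by linarith) hp0
  have hpos : ∀ s t, 0 ≤ s → s ≤ t → t ≤ T → 0 ≤ ω s t := by
    intro s t h0 h1 h2
    by_contra hneg
    push Not at hneg
    have h3 := (norm_nonneg _).trans (hx s t h0 h1 h2)
    rw [Real.rpow_def_of_neg hneg] at h3
    have h4 : Real.cos (1 / p * Real.pi) < 0 := by
      have hpi := Real.pi_pos
      apply Real.cos_neg_of_pi_div_two_lt_of_lt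
      · have : 1 / 2 < 1 / p := one_div_lt_one_div_of_lt hp0 (by linarith)
        nlinarith
      · have : 1 / p ≤ 1 := by rw [div_le_one hp0]; exact hp
        nlinarith
    have := mul_neg_of_pos_of_neg (Real.exp_pos (Real.log (ω s t) * (1 / p))) h4
    linarith
  obtain ⟨hmono, h0, hlast⟩ := htt
  obtain ⟨_, _, hE⟩ := hE
  let τ : ℕ → ℝ := fun i => tt ⟨min i N, by omega⟩
  have hτ : Monotone τ := by
    intro a b hab
    apply hmono.monotone
    simp only [Fin.mk_le_mk]
    omega
  have hτN : ∀ i, τ i ≤ T := by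
    intro i
    rw [← hlast]
    exact hmono.monotone (Fin.le_last _)
  have hτ0 : τ 0 = 0 := by
    rw [← h0]
    change tt _ = tt _
    congr 1
  have hk : ∀ k : Fin (N + 1), τ k = tt k := by
    intro k
    change tt _ = tt _
    congr 1
    ext
    change min (k : ℕ) N = k
    omega
  have hsol : ∀ i < N, SkorohodSol D (τ i) (τ (i + 1))
      (fun u => y (τ i) + σ (y (τ i)) (x u - x (τ i))) y (fun u => Φ u - Φ (τ i)) := by
    intro i hi
    have := hE ⟨i, hi⟩
    rw [← hk, ← hk] at this
    exact this
  have hTN : τ N = T := by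
    rw [← hlast, ← hk]; rfl
  have hmain := core hp hC₀ f3 f4 hM0 hγp hC₁ hC₂ G f1 f2 hC hω hpos hx hτ hτ0 hτN
    (fun i hi => Seg.of_sol (hτ (Nat.le_succ i)) (hsol i hi))
    (fun i hi u hu => (hsol i hi).eqn u hu)
    (N - k) k (by omega) t (by rw [hk]; exact hks.trans hst)
    (by rw [show (k : ℕ) + (N - k) = N by omega, hTN]; exact htT) (by rw [hk]; exact hte)
  rw [hk] at hmain
  exact ⟨hmain.1, hmain.2 s hks hst⟩

end
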